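/- arXiv:2007.12141 — 2 statements merged into one kernel-verified Lean document; each statement's English description precedes it below -/
import Mathlib

section
/- Let (𝒳,F,h) and (𝒳̄,F̄,h̄) be two state-space systems with the same input set 𝒵 and output set 𝒴 that both have the echo state property and satisfy H^F_h = H^{F̄}_{h̄}. If both systems are canonical (strongly reachable and observable), then they are system isomorphic: the unique morphism f : 𝒳 → 𝒳̄ with f(H^F(z)) = H^{F̄}(z) is a bijection whose inverse is the unique morphism in the opposite direction. -/
/-!
Semi-infinite sequences `z : ℤ₋ → α` are encoded as `ℕ → α` via `n ↦ z_{-n}`.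
-/

/-- Concatenation `z z̃` of `z ∈ α^{ℤ₋}` with a finite word `z̃ = (z̃_1, …, z̃_T)`. -/
def concat {α : Type*} (z : ℕ → α) {T : ℕ} (w : Fin T → α) : ℕ → α := fun n =>
  if h : n < T then w ⟨T - 1 - n, by omega⟩ else z (n - T)

/-- `x` is a solution of the state system with state map `F` for the input `z`. -/
def IsSolution {X Z : Type*} (F : X → Z → X) (z : ℕ → Z) (x : ℕ → X) : Prop :=
  ∀ n : ℕ, x n = F (x (n + 1)) (z n)

/-- Echo state property: every input has exactly one solution. -/
def ESP {X Z : Type*} (F : X → Z → X) : Prop :=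
  ∀ z : ℕ → Z, ∃! x : ℕ → X, IsSolution F z x

/-- `f` is a morphism of state-space systems: system equivariant and readout invariant. -/
def IsMorphism {X₁ X₂ Z Y : Type*} (F₁ : X₁ → Z → X₁) (h₁ : X₁ → Y)
    (F₂ : X₂ → Z → X₂) (h₂ : X₂ → Y) (f : X₁ → X₂) : Prop :=
  (∀ (x : X₁) (z : Z), f (F₁ x z) = F₂ (f x) z) ∧ ∀ x : X₁, h₁ x = h₂ (f x)

theorem concat_add {α : Type*} (z : ℕ → α) {T : ℕ} (w : Fin T → α) (n : ℕ) :
    concat z w (n + T) = z n := by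
  simp [concat]

/-- Concatenating a finite word on the right only shifts the past of the solution. -/
theorem ESP.solution_concat_add {X Z : Type*} {F : X → Z → X} (hE : ESP F)
    {U : (ℕ → Z) → ℕ → X} (hU : ∀ z, IsSolution F z (U z))
    (z : ℕ → Z) {T : ℕ} (w : Fin T → Z) (n : ℕ) :
    U (concat z w) (n + T) = U z n := by
  have hs : IsSolution F z (fun n => U (concat z w) (n + T)) := fun n => by
    have h := hU (concat z w) (n + T)
    rw [concat_add] at h
    simpa only [Nat.add_right_comm] using h
  exact congrFun ((hE z).unique hs (hU z)) n

/-- The final state after reading a word depends only on the initial state and the word. -/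
theorem ESP.solution_concat_congr {X Z : Type*} {F : X → Z → X} (hE : ESP F)
    {U : (ℕ → Z) → ℕ → X} (hU : ∀ z, IsSolution F z (U z))
    {z₁ z₂ : ℕ → Z} (hz : U z₁ 0 = U z₂ 0) {T : ℕ} (w : Fin T → Z) :
    U (concat z₁ w) 0 = U (concat z₂ w) 0 := by
  have key : ∀ k ≤ T, U (concat z₁ w) k = U (concat z₂ w) k := by
    intro k hk
    induction hk using Nat.decreasingInduction with
    | self =>
      have h₁ := hE.solution_concat_add hU z₁ w 0
      have h₂ := hE.solution_concat_add hU z₂ w 0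
      rw [Nat.zero_add] at h₁ h₂
      rw [h₁, h₂, hz]
    | of_succ k hk ih =>
      rw [hU (concat z₁ w) k, hU (concat z₂ w) k, ih]
      simp [concat, hk]
  exact key 0 T.zero_le

/-- Reading one more input applies the state map once. -/
theorem ESP.solution_concat_singleton {X Z : Type*} {F : X → Z → X} (hE : ESP F)
    {U : (ℕ → Z) → ℕ → X} (hU : ∀ z, IsSolution F z (U z)) (z : ℕ → Z) (a : Z) :
    U (concat z (fun _ : Fin 1 => a)) 0 = F (U z 0) a := by
  rw [hU (concat z _) 0, hE.solution_concat_add hU z (fun _ : Fin 1 => a) 0]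
  simp [concat]

/-- A morphism sends solutions to solutions, hence respects the state filters. -/
theorem IsMorphism.map_solution {X X' Z Y : Type*} {F : X → Z → X} {h : X → Y}
    {F' : X' → Z → X'} {h' : X' → Y} {f : X → X'} (hf : IsMorphism F h F' h' f) (hE' : ESP F')
    {U : (ℕ → Z) → ℕ → X} (hU : ∀ z, IsSolution F z (U z))
    {U' : (ℕ → Z) → ℕ → X'} (hU' : ∀ z, IsSolution F' z (U' z)) (z : ℕ → Z) :
    f (U z 0) = U' z 0 := by
  have hs : IsSolution F' z (fun n => f (U z n)) := fun n => by
    show f (U z n) = _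
    rw [hU z n, hf.1]
  exact congrFun ((hE' z).unique hs (hU' z)) 0

/-- A strongly reachable system maps by a morphism to any observable system with the same
input/output behaviour. -/
theorem exists_isMorphism {X X' Z Y : Type*} {F : X → Z → X} {h : X → Y}
    {F' : X' → Z → X'} {h' : X' → Y} (hE : ESP F) (hE' : ESP F')
    {U : (ℕ → Z) → ℕ → X} (hU : ∀ z, IsSolution F z (U z))
    {U' : (ℕ → Z) → ℕ → X'} (hU' : ∀ z, IsSolution F' z (U' z))
    (hsame : ∀ z, h (U z 0) = h' (U' z 0))
    (hreach : ∀ x : X, ∃ z : ℕ → Z, U z 0 = x)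
    (hobs' : ∀ z₁ z₂ : ℕ → Z,
      (∀ (T : ℕ) (w : Fin T → Z), h' (U' (concat z₁ w) 0) = h' (U' (concat z₂ w) 0)) →
      U' z₁ 0 = U' z₂ 0) :
    ∃ f : X → X', IsMorphism F h F' h' f ∧ ∀ z, f (U z 0) = U' z 0 := by
  choose s hs using hreach
  have hf : ∀ z, U' (s (U z 0)) 0 = U' z 0 := fun z =>
    hobs' _ _ fun T w => by
      rw [← hsame, ← hsame, hE.solution_concat_congr hU (hs (U z 0)) w]
  refine ⟨fun x => U' (s x) 0, ⟨fun x a => ?_, fun x => ?_⟩, hf⟩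
  · show U' (s (F x a)) 0 = F' (U' (s x) 0) a
    rw [← hE'.solution_concat_singleton hU', ← hf (concat (s x) _),
      hE.solution_concat_singleton hU, hs]
  · show h x = h' (U' (s x) 0)
    rw [← hsame, hs]

/-- two canonical (strongly reachable and observable) systems with the ESP
realizing the same input/output system are system isomorphic: there are mutually inverse
morphisms `f`, `g`, each unique in its direction, with `f (H^F z) = H^{F̄} z`. -/
theorem stmt4 {X X' Z Y : Type*} (F : X → Z → X) (h : X → Y)
    (F' : X' → Z → X') (h' : X' → Y)
    (hE : ESP F) (hE' : ESP F')
    (U : (ℕ → Z) → ℕ → X) (hU : ∀ z : ℕ → Z, IsSolution F z (U z))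
    (U' : (ℕ → Z) → ℕ → X') (hU' : ∀ z : ℕ → Z, IsSolution F' z (U' z))
    (hsame : ∀ z : ℕ → Z, h (U z 0) = h' (U' z 0))
    (hreach : ∀ x : X, ∃ z : ℕ → Z, U z 0 = x)
    (hreach' : ∀ x : X', ∃ z : ℕ → Z, U' z 0 = x)
    (hobs : ∀ z₁ z₂ : ℕ → Z,
      (∀ (T : ℕ) (w : Fin T → Z), h (U (concat z₁ w) 0) = h (U (concat z₂ w) 0)) →
      U z₁ 0 = U z₂ 0)
    (hobs' : ∀ z₁ z₂ : ℕ → Z,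
      (∀ (T : ℕ) (w : Fin T → Z), h' (U' (concat z₁ w) 0) = h' (U' (concat z₂ w) 0)) →
      U' z₁ 0 = U' z₂ 0) :
    ∃ (f : X → X') (g : X' → X),
      IsMorphism F h F' h' f ∧ IsMorphism F' h' F h g ∧
      (∀ x : X, g (f x) = x) ∧ (∀ x : X', f (g x) = x) ∧
      Function.Bijective f ∧
      (∀ z : ℕ → Z, f (U z 0) = U' z 0) ∧
      (∀ f' : X → X', IsMorphism F h F' h' f' → f' = f) ∧
      (∀ g' : X' → X, IsMorphism F' h' F h g' → g' = g) := by
  obtain ⟨f, hf, hfU⟩ := exists_isMorphism hE hE' hU hU' hsame hreach hobs'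
  obtain ⟨g, hg, hgU⟩ := exists_isMorphism hE' hE hU' hU (fun z => (hsame z).symm) hreach' hobs
  have hgf : ∀ x, g (f x) = x := fun x => by
    obtain ⟨z, rfl⟩ := hreach x
    rw [hfU, hgU]
  have hfg : ∀ x, f (g x) = x := fun x => by
    obtain ⟨z, rfl⟩ := hreach' x
    rw [hgU, hfU]
  refine ⟨f, g, hf, hg, hgf, hfg, Function.bijective_iff_has_inverse.2 ⟨g, hgf, hfg⟩, hfU,
    fun f' hf' => funext fun x => ?_, fun g' hg' => funext fun x => ?_⟩
  · obtain ⟨z, rfl⟩ := hreach x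
    rw [hf'.map_solution hE' hU hU', hfU]
  · obtain ⟨z, rfl⟩ := hreach' x
    rw [hg'.map_solution hE hU' hU, hgU]
end

section
/- Let N ∈ ℕ, A an N×N real matrix with spectral radius ρ(A) < 1, C ∈ ℝ^N, and W a 1×N real matrix. Then Σ_{j=0}^∞ |W A^j C| < ∞, and the linear state-space filter U^F_h : ℓ∞₋(ℝ) → ℓ∞₋(ℝ) defined by U^F_h(z)_t := Σ_{j=0}^∞ W A^j C z_{t−j} is well defined (maps into ℓ∞₋(ℝ)) and has the input forgetting property; indeed U^F_h(z) = Ψ ∗ z with Ψ ∈ ℓ¹₋(ℝ) given by Ψ_{−j} := W A^j C for j ∈ ℕ. -/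
open Matrix Filter Topology

/-- The convolution `(Ψ ∗ z)_t = Σ_{j ≤ 0} Ψ_j z_{t+j}` in reversed indexing. -/
noncomputable def conv (Ψ : ℕ → ℝ) (z : ℕ → ℝ) (n : ℕ) : ℝ := ∑' k : ℕ, Ψ k * z (n + k)

/-- A sequence is bounded, i.e. belongs to `ℓ∞₋`. -/
def BddSeq {E : Type*} [Norm E] (z : ℕ → E) : Prop := ∃ M : ℝ, ∀ n : ℕ, ‖z n‖ ≤ M

/-- In a complex Banach algebra, the powers of an element of spectral radius less than one are
absolutely summable. -/
lemma summable_norm_pow_of_spectralRadius_lt_one {R : Type*} [NormedRing R] [NormedAlgebra ℂ R]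
    [CompleteSpace R] {a : R} (ha : spectralRadius ℂ a < 1) : Summable fun n : ℕ => ‖a ^ n‖ := by
  obtain ⟨r, har, hr⟩ := ENNReal.lt_iff_exists_nnreal_btwn.1 ha
  have hr1 : r < 1 := by exact_mod_cast hr
  have hev := (spectrum.pow_nnnorm_pow_one_div_tendsto_nhds_spectralRadius a).eventually_lt_const har
  refine Summable.of_norm_bounded_eventually_nat
    (summable_geometric_of_lt_one r.coe_nonneg (by exact_mod_cast hr1)) ?_
  filter_upwards [hev, eventually_gt_atTop 0] with n hn hn0
  have hn' : (0 : ℝ) < n := by exact_mod_cast hn0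
  rw [one_div, ENNReal.rpow_inv_lt_iff hn', ENNReal.rpow_natCast] at hn
  rw [norm_norm]
  exact_mod_cast hn.le

section MatrixNorm

attribute [local instance] Matrix.linftyOpNormedAddCommGroup Matrix.linftyOpNormedRing
  Matrix.linftyOpNormedSpace Matrix.linftyOpNormedAlgebra

/-- The coefficients `W A^j C` of a linear state-space system with `ρ(A) < 1` are absolutely
summable. -/
lemma summable_abs_dotProduct_pow_mulVec {ι : Type*} [Fintype ι] [DecidableEq ι]
    {A : Matrix ι ι ℝ} (hA : spectralRadius ℂ (A.map (algebraMap ℝ ℂ)) < 1) (C W : ι → ℝ) :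
    Summable fun j : ℕ => |W ⬝ᵥ (A ^ j).mulVec C| := by
  let c : (ι → ℝ) → ι → ℂ := fun v i => algebraMap ℝ ℂ (v i)
  refine Summable.of_nonneg_of_le (fun _ => abs_nonneg _) (fun j => ?_)
    ((summable_norm_pow_of_spectralRadius_lt_one hA).mul_left ((∑ i, ‖c W i‖) * ‖c C‖))
  have hpow : A.map (algebraMap ℝ ℂ) ^ j = (A ^ j).map (algebraMap ℝ ℂ) :=
    (map_pow (algebraMap ℝ ℂ).mapMatrix A j).symm
  have hcast : c W ⬝ᵥ (A.map (algebraMap ℝ ℂ) ^ j).mulVec (c C)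
      = ((W ⬝ᵥ (A ^ j).mulVec C : ℝ) : ℂ) := by
    rw [hpow]
    simp [c, dotProduct, mulVec]
  rw [← Real.norm_eq_abs, ← Complex.norm_real, ← hcast, mul_assoc, Finset.sum_mul]
  refine norm_sum_le_of_le _ fun i _ => ?_
  rw [norm_mul, mul_comm ‖c C‖]
  exact mul_le_mul_of_nonneg_left
    ((norm_le_pi_norm _ i).trans (linfty_opNorm_mulVec _ _)) (norm_nonneg _)

end MatrixNorm

lemma BddSeq.concat {E : Type*} [NormedAddCommGroup E] {z : ℕ → E} (hz : BddSeq z) {T : ℕ}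
    (w : Fin T → E) : BddSeq (concat z w) := by
  obtain ⟨M, hM⟩ := hz
  refine ⟨max M ‖w‖, fun n => ?_⟩
  unfold _root_.concat
  split_ifs
  · exact (norm_le_pi_norm w _).trans (le_max_right _ _)
  · exact (hM _).trans (le_max_left _ _)

section Conv

variable {Ψ : ℕ → ℝ}

lemma abs_conv_term_le {z : ℕ → ℝ} {M : ℝ} (hM : ∀ n, ‖z n‖ ≤ M) (n k : ℕ) :
    ‖Ψ k * z (n + k)‖ ≤ |Ψ k| * M := by
  rw [norm_mul, Real.norm_eq_abs]
  exact mul_le_mul_of_nonneg_left (hM _) (abs_nonneg _)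

lemma BddSeq.summable_conv (hΨ : Summable fun k => |Ψ k|) {z : ℕ → ℝ} (hz : BddSeq z) (n : ℕ) :
    Summable fun k => Ψ k * z (n + k) :=
  let ⟨M, hM⟩ := hz
  Summable.of_norm_bounded (hΨ.mul_right M) (abs_conv_term_le hM n)

lemma BddSeq.conv (hΨ : Summable fun k => |Ψ k|) {z : ℕ → ℝ} (hz : BddSeq z) :
    BddSeq (conv Ψ z) :=
  let ⟨M, hM⟩ := hz
  ⟨∑' k, |Ψ k| * M, fun n =>
    tsum_of_norm_bounded (hΨ.mul_right M).hasSum (abs_conv_term_le hM n)⟩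

/-- Convolution with an `ℓ¹` kernel has the input forgetting property. -/
lemma tendsto_abs_conv_concat_sub (hΨ : Summable fun k => |Ψ k|) {u v : ℕ → ℝ} (hu : BddSeq u)
    (hv : BddSeq v) (z : ℕ → ℝ) :
    Tendsto (fun t : ℕ => |conv Ψ (concat u fun i : Fin t => z i) 0
      - conv Ψ (concat v fun i : Fin t => z i) 0|) atTop (𝓝 0) := by
  have hsub (t : ℕ) : conv Ψ (concat u fun i : Fin t => z i) 0
      - conv Ψ (concat v fun i : Fin t => z i) 0 =
      ∑' k, Ψ k * (if k < t then 0 else u (k - t) - v (k - t)) := by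
    unfold conv
    rw [← ((hu.concat _).summable_conv hΨ 0).tsum_sub ((hv.concat _).summable_conv hΨ 0)]
    refine tsum_congr fun k => ?_
    rw [← mul_sub, zero_add]
    unfold concat
    split_ifs <;> simp
  obtain ⟨Mu, hMu⟩ := hu
  obtain ⟨Mv, hMv⟩ := hv
  have hlim : Tendsto (fun t : ℕ => ∑' k, Ψ k * (if k < t then 0 else u (k - t) - v (k - t)))
      atTop (𝓝 (∑' _ : ℕ, (0 : ℝ))) := by
    refine tendsto_tsum_of_dominated_convergence (hΨ.mul_right (Mu + Mv)) (fun k => ?_)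
      (Eventually.of_forall fun t k => ?_)
    · refine tendsto_const_nhds.congr' ?_
      filter_upwards [eventually_gt_atTop k] with t ht
      simp [ht]
    · rw [norm_mul, Real.norm_eq_abs]
      refine mul_le_mul_of_nonneg_left ?_ (abs_nonneg _)
      split_ifs
      · rw [norm_zero]
        exact add_nonneg ((norm_nonneg _).trans (hMu 0)) ((norm_nonneg _).trans (hMv 0))
      · exact (norm_sub_le _ _).trans (add_le_add (hMu _) (hMv _))
  simp only [hsub]
  simpa using hlim.abs

end Conv

/-- if `ρ(A) < 1` then `Σ_j |W A^j C| < ∞`, i.e. the kernel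
`Ψ_{-j} := W A^j C` belongs to `ℓ¹₋(ℝ)`, the linear state-space filter
`U^F_h(z)_t = Σ_{j≥0} W A^j C z_{t-j} = (Ψ ∗ z)_t` maps `ℓ∞₋(ℝ)` into `ℓ∞₋(ℝ)`, and it
has the input forgetting property. -/
theorem stmt15 (N : ℕ) (A : Matrix (Fin N) (Fin N) ℝ)
    (hA : spectralRadius ℂ (A.map (algebraMap ℝ ℂ)) < 1) (C W : Fin N → ℝ) :
    Summable (fun j : ℕ => |W ⬝ᵥ (A ^ j).mulVec C|) ∧
    (∀ z : ℕ → ℝ, BddSeq z → BddSeq (conv (fun j : ℕ => W ⬝ᵥ (A ^ j).mulVec C) z)) ∧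
    (∀ u v : ℕ → ℝ, BddSeq u → BddSeq v → ∀ z : ℕ → ℝ,
      Tendsto (fun t : ℕ =>
          |conv (fun j : ℕ => W ⬝ᵥ (A ^ j).mulVec C) (concat u fun i : Fin t => z i) 0
            - conv (fun j : ℕ => W ⬝ᵥ (A ^ j).mulVec C) (concat v fun i : Fin t => z i) 0|)
        atTop (𝓝 0)) := by
  have hΨ := summable_abs_dotProduct_pow_mulVec hA C W
  exact ⟨hΨ, fun _ hz => hz.conv hΨ, fun _ _ hu hv z => tendsto_abs_conv_concat_sub hΨ hu hv z⟩
end
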